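/- FarSight encodes absolute position in its outputs: let σ > 0, suppose ω_{ij} = c for all j ≤ i (for a fixed real c), and let V ∈ ℝ^{n×d} have all rows equal to a fixed vector v ∈ ℝ^d. Then row i of the product W̃·V equals β_i • v, where β_i = Σ_{j=1}^{i} W̃_{ij}; consequently, if v ≠ 0, the rows of W̃·V are pairwise distinct, so distinct positions produce distinct outputs. -/

import Mathlib

open Finset

/-- The causal indicator matrix `C`, with `C i j = 1` if `j ≤ i` and `0` otherwise. -/
noncomputable def Cmask (n : ℕ) : Matrix (Fin n) (Fin n) ℝ :=
  fun i j => if j ≤ i then 1 else 0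

/-- The register matrix `P`, with `P i j = −(j−i)·σ` if `j > i` and `0` otherwise. -/
noncomputable def Pmat (n : ℕ) (σ : ℝ) : Matrix (Fin n) (Fin n) ℝ :=
  fun i j => if i < j then -(((j : ℕ) : ℝ) - ((i : ℕ) : ℝ)) * σ else 0

/-- `W = ω ⊙ C + P` (entrywise product with the causal mask, plus the registers). -/
noncomputable def Wmat (n : ℕ) (σ : ℝ) (ω : Matrix (Fin n) (Fin n) ℝ) :
    Matrix (Fin n) (Fin n) ℝ :=
  fun i j => ω i j * Cmask n i j + Pmat n σ i j

/-- Row-wise softmax: `S(M) i j = exp (M i j) / ∑ k, exp (M i k)`. -/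
noncomputable def softmaxRow (n : ℕ) (M : Matrix (Fin n) (Fin n) ℝ) :
    Matrix (Fin n) (Fin n) ℝ :=
  fun i j => Real.exp (M i j) / ∑ k, Real.exp (M i k)

/-- The FarSight attention matrix `W̃ = S(W) ⊙ C`. -/
noncomputable def Wtilde (n : ℕ) (σ : ℝ) (ω : Matrix (Fin n) (Fin n) ℝ) :
    Matrix (Fin n) (Fin n) ℝ :=
  fun i j => softmaxRow n (Wmat n σ ω) i j * Cmask n i j

/-- The vanilla causal softmax `A`, with `A i j = exp (ω i j) / ∑_{k ≤ i} exp (ω i k)`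
for `j ≤ i` and `A i j = 0` for `j > i`. -/
noncomputable def Avanilla (n : ℕ) (ω : Matrix (Fin n) (Fin n) ℝ) :
    Matrix (Fin n) (Fin n) ℝ :=
  fun i j => if j ≤ i then Real.exp (ω i j) / ∑ k ∈ Finset.Iic i, Real.exp (ω i k) else 0

theorem sum_Iic_Wtilde_of_uniform (n : ℕ) (σ c : ℝ) (ω : Matrix (Fin (n + 1)) (Fin (n + 1)) ℝ)
    (hω : ∀ i j : Fin (n + 1), j ≤ i → ω i j = c) (i : Fin (n + 1)) :
    ∑ j ∈ Finset.Iic i, Wtilde (n + 1) σ ω i j =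
      ((i : ℕ) + 1) * Real.exp c /
        (((i : ℕ) + 1) * Real.exp c +
          ∑ m ∈ Finset.range (n - i), Real.exp (-((m : ℝ) + 1) * σ)) := by
  have hden : ∑ k, Real.exp (Wmat (n + 1) σ ω i k) = ((i : ℕ) + 1) * Real.exp c +
      ∑ m ∈ Finset.range (n - i), Real.exp (-((m : ℝ) + 1) * σ) := by
    let f : ℕ → ℝ := fun k =>
      if (i : ℕ) < k then Real.exp (-((k : ℝ) - (i : ℕ)) * σ) else Real.exp c
    have hf : ∀ k : Fin (n + 1), Real.exp (Wmat (n + 1) σ ω i k) = f k := by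
      intro k
      by_cases h : i < k
      · simp [Wmat, Cmask, Pmat, f, h, not_le.mpr h]
      · simp [Wmat, Cmask, Pmat, f, h, not_lt.mp h, hω i k (not_lt.mp h)]
    have hn : Finset.range (n + 1) = Finset.range (((i : ℕ) + 1) + (n - i)) := by
      congr 1; omega
    rw [Finset.sum_congr rfl fun k _ => hf k, Fin.sum_univ_eq_sum_range f (n + 1), hn,
      Finset.sum_range_add]
    congr 1
    · rw [Finset.sum_congr rfl (g := fun _ => Real.exp c)]
      · simp
      · intro k hk
        have : ¬ (i : ℕ) < k := by simp at hk; omega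
        simp [f, this]
    · refine Finset.sum_congr rfl fun m _ => ?_
      have : (i : ℕ) < (i : ℕ) + 1 + m := by omega
      simp only [f, this, if_true]
      push_cast
      ring_nf
  have hterm : ∀ j ∈ Finset.Iic i, Wtilde (n + 1) σ ω i j =
      Real.exp c / ∑ k, Real.exp (Wmat (n + 1) σ ω i k) := by
    intro j hj
    have hj' : j ≤ i := Finset.mem_Iic.mp hj
    have hW : Wmat (n + 1) σ ω i j = c := by
      simp [Wmat, Cmask, Pmat, hj', not_lt.mpr hj', hω i j hj']
    simp [Wtilde, softmaxRow, Cmask, hj', hW]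
  rw [Finset.sum_congr rfl hterm, Finset.sum_const, Fin.card_Iic, hden, nsmul_eq_mul]
  push_cast
  ring

theorem strictMono_sum_Iic_Wtilde_of_uniform (n : ℕ) (σ c : ℝ)
    (ω : Matrix (Fin (n + 1)) (Fin (n + 1)) ℝ)
    (hω : ∀ i j : Fin (n + 1), j ≤ i → ω i j = c) :
    StrictMono fun i : Fin (n + 1) => ∑ j ∈ Finset.Iic i, Wtilde (n + 1) σ ω i j := by
  intro i i' h
  simp only [sum_Iic_Wtilde_of_uniform n σ c ω hω]
  have hii' : (i : ℕ) < i' := h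
  have hT : ∑ m ∈ Finset.range (n - i'), Real.exp (-((m : ℝ) + 1) * σ) ≤
      ∑ m ∈ Finset.range (n - i), Real.exp (-((m : ℝ) + 1) * σ) :=
    Finset.sum_le_sum_of_subset_of_nonneg (Finset.range_subset_range.mpr (by omega))
      fun _ _ _ => (Real.exp_pos _).le
  have hT' : 0 ≤ ∑ m ∈ Finset.range (n - i'), Real.exp (-((m : ℝ) + 1) * σ) :=
    Finset.sum_nonneg fun _ _ => (Real.exp_pos _).le
  have hTpos : 0 < ∑ m ∈ Finset.range (n - i), Real.exp (-((m : ℝ) + 1) * σ) :=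
    Finset.sum_pos (fun _ _ => Real.exp_pos _) ⟨0, Finset.mem_range.mpr (by omega)⟩
  have ha : 0 < ((i : ℕ) + 1 : ℝ) * Real.exp c := by positivity
  have haa' : ((i : ℕ) + 1 : ℝ) * Real.exp c < ((i' : ℕ) + 1) * Real.exp c := by gcongr
  rw [div_lt_div_iff₀ (by linarith) (by linarith)]
  nlinarith [mul_le_mul_of_nonneg_left hT ha.le, mul_lt_mul_of_pos_right haa' hTpos]

theorem Wtilde_mul_row_of_const_rows (n d : ℕ) (σ : ℝ) (ω : Matrix (Fin n) (Fin n) ℝ)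
    (v : Fin d → ℝ) (V : Matrix (Fin n) (Fin d) ℝ) (hV : ∀ r, V r = v) (i : Fin n) :
    (Wtilde n σ ω * V) i = (∑ j ∈ Finset.Iic i, Wtilde n σ ω i j) • v := by
  ext k
  rw [Matrix.mul_apply, Pi.smul_apply, smul_eq_mul, Finset.sum_mul]
  simp only [hV]
  refine (Finset.sum_subset (Finset.subset_univ _) fun j _ hj => ?_).symm
  simp [Wtilde, Cmask, Finset.mem_Iic.not.mp hj]

/-- FarSight encodes absolute position in its outputs: if `σ > 0`, the score matrix is
uniform on valid positions (`ω i j = c` for all `j ≤ i`), and `V ∈ ℝ^{n×d}` has all rows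
equal to a fixed `v ∈ ℝ^d`, then row `i` of `W̃·V` equals `β i • v` where
`β i = ∑_{j ≤ i} W̃ i j`; consequently, if `v ≠ 0` the rows of `W̃·V` are pairwise
distinct, so distinct positions produce distinct outputs. -/
theorem farsight_absolute_position (n d : ℕ) (σ : ℝ) (hσ : 0 < σ) (c : ℝ)
    (ω : Matrix (Fin (n + 1)) (Fin (n + 1)) ℝ)
    (hω : ∀ i j : Fin (n + 1), j ≤ i → ω i j = c)
    (v : Fin d → ℝ) (V : Matrix (Fin (n + 1)) (Fin d) ℝ) (hV : ∀ r, V r = v) :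
    (∀ i : Fin (n + 1),
      (Wtilde (n + 1) σ ω * V) i = (∑ j ∈ Finset.Iic i, Wtilde (n + 1) σ ω i j) • v) ∧
    (v ≠ 0 → ∀ i i' : Fin (n + 1), i ≠ i' →
      (Wtilde (n + 1) σ ω * V) i ≠ (Wtilde (n + 1) σ ω * V) i') := by
  have hrow := Wtilde_mul_row_of_const_rows (n + 1) d σ ω v V hV
  refine ⟨hrow, fun hv i i' hne heq => hne ?_⟩
  rw [hrow, hrow] at heq
  exact (strictMono_sum_Iic_Wtilde_of_uniform n σ c ω hω).injective
    (smul_left_injective ℝ hv heq)
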